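/- Let n ∈ ℕ, n ≥ 1, and let N ⊆ ℝ^{n×n} be the set of A ∈ ℝ^{n×n} with 0 ∉ σ(A), |σ(A)| = n, and possessing an eigenvalue λ₁ with Re μ < Re λ₁ for all μ ∈ σ(A) \ {λ₁, conj(λ₁)}. Then the set M of all A ∈ N for which there exists an invertible matrix G ∈ ℂ^{n×n} with H := G⁻¹ such that H A G = diag(λ₁, …, λₙ) is diagonal, the first diagonal entry λ₁ satisfies Re λ₁ = max{Re λ : λ ∈ σ(A)}, and g₁₁ · h₁₁ ≠ 0 (where g₁₁ and h₁₁ are the (1,1)-entries of G and H respectively), is open and dense in ℝ^{n×n}. -/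

import Mathlib

open Matrix

/-- The complex eigenvalues of a real matrix. -/
def eigenvalues {n : ℕ} (A : Matrix (Fin n) (Fin n) ℝ) : Set ℂ :=
  {μ : ℂ | ∃ v : Fin n → ℂ, v ≠ 0 ∧ (A.map (fun x : ℝ => (x : ℂ))).mulVec v = μ • v}

open Polynomial Filter Topology

/-- The principal minor of the characteristic matrix obtained by deleting row and column `i`. -/
noncomputable def Matrix.cornerMinor {m R : Type*} [Fintype m] [DecidableEq m] [CommRing R]
    (i : m) (A : Matrix m m R) : R[X] :=
  A.charmatrix.adjugate i i

/-- A polynomial in the entries of `A` which is nonzero exactly when `A` is invertible, has simple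
spectrum, and `cornerMinor i A` vanishes at no eigenvalue. -/
noncomputable def Matrix.genericity {m R : Type*} [Fintype m] [DecidableEq m] [CommRing R]
    (i : m) (A : Matrix m m R) : R :=
  (A * aeval A (derivative A.charpoly) * aeval A (A.cornerMinor i)).det

section CommRing

variable {m R S : Type*} [Fintype m] [DecidableEq m] [CommRing R] [CommRing S]

theorem Matrix.eval_cornerMinor (i : m) (A : Matrix m m R) (t : R) :
    (A.cornerMinor i).eval t = (scalar m t - A).adjugate i i := by
  have h : (evalRingHom t).mapMatrix A.charmatrix = scalar m t - A := by
    ext a b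
    by_cases hab : a = b
    · subst hab; simp
    · simp [hab]
  rw [← h, ← RingHom.map_adjugate]
  rfl

theorem Matrix.cornerMinor_map (f : R →+* S) (i : m) (A : Matrix m m R) :
    (A.map f).cornerMinor i = (A.cornerMinor i).map f := by
  have h : (mapRingHom f).mapMatrix A.charmatrix = (A.map f).charmatrix := by
    rw [RingHom.mapMatrix_apply, coe_mapRingHom, charmatrix_map]
  unfold cornerMinor
  rw [← h, ← RingHom.map_adjugate]
  rfl

theorem Matrix.map_aeval (f : R →+* S) (A : Matrix m m R) (p : R[X]) :
    (aeval A p).map f = aeval (A.map f) (p.map f) := by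
  refine Polynomial.map_aeval_eq_aeval_map (ψ := f.mapMatrix) (φ := f) ?_ p A
  ext r a b
  by_cases hab : a = b
  · subst hab; simp [algebraMap_eq_diagonal]
  · simp [algebraMap_eq_diagonal, hab]

theorem Matrix.genericity_map (f : R →+* S) (i : m) (A : Matrix m m R) :
    (A.map f).genericity i = f (A.genericity i) := by
  unfold genericity
  rw [RingHom.map_det, map_mul, map_mul, RingHom.mapMatrix_apply, RingHom.mapMatrix_apply,
    RingHom.mapMatrix_apply, map_aeval, map_aeval, cornerMinor_map, charpoly_map, derivative_map]

theorem Matrix.aeval_mul_of_mul_eq_mul_diagonal {A G : Matrix m m R} {d : m → R}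
    (h : A * G = G * diagonal d) (p : R[X]) :
    aeval A p * G = G * diagonal fun i => p.eval (d i) := by
  have hpow : ∀ k : ℕ, A ^ k * G = G * diagonal (d ^ k) := by
    intro k
    rw [← diagonal_pow]
    exact ((show SemiconjBy G (diagonal d) A from h.symm).pow_right k).symm
  induction p using Polynomial.induction_on' with
  | add p q hp hq =>
    simp only [map_add, add_mul, hp, hq, eval_add, ← mul_add, diagonal_add]
  | monomial k a =>
    rw [aeval_monomial, ← Algebra.smul_def, smul_mul_assoc, hpow, ← mul_smul_comm]
    congr 1
    ext x y
    by_cases hxy : x = y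
    · subst hxy; simp
    · simp [hxy]

theorem Matrix.det_aeval_of_mul_eq_mul_diagonal {A G H : Matrix m m R} {d : m → R}
    (hGH : G * H = 1) (h : A * G = G * diagonal d) (p : R[X]) :
    (aeval A p).det = ∏ i, p.eval (d i) := by
  have h1 : aeval A p = G * (diagonal fun i => p.eval (d i)) * H := by
    rw [← aeval_mul_of_mul_eq_mul_diagonal h, mul_assoc, hGH, mul_one]
  have h2 : G.det * H.det = 1 := by rw [← det_mul, hGH, det_one]
  rw [h1, det_mul, det_mul, mul_right_comm, h2, one_mul, det_diagonal]

theorem Matrix.eval_cornerMinor_of_mul_eq_mul_diagonal {A G H : Matrix m m R} {d : m → R}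
    (hGH : G * H = 1) (h : A * G = G * diagonal d) (i j : m) :
    (A.cornerMinor i).eval (d j) = G i j * H j i * ∏ k ∈ Finset.univ.erase j, (d j - d k) := by
  have hHG : H * G = 1 := mul_eq_one_comm.mp hGH
  have h1 : scalar m (d j) - A = G * (diagonal fun k => d j - d k) * H := by
    have : (diagonal fun k => d j - d k) = scalar m (d j) - diagonal d := by
      rw [scalar_apply, diagonal_sub]
    rw [this, mul_sub, sub_mul, ← h, mul_assoc A, hGH, mul_one,
      ← (scalar_commute (d j) (fun r => mul_comm _ _) G).eq, mul_assoc, hGH, mul_one]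
  have hG : G.adjugate = G.det • H := by
    have : H * (G * G.adjugate) = H * (G.det • 1) := by rw [mul_adjugate]
    rwa [← mul_assoc, hHG, one_mul, mul_smul_comm, mul_one] at this
  have hH : H.adjugate = H.det • G := by
    have : G * (H * H.adjugate) = G * (H.det • 1) := by rw [mul_adjugate]
    rwa [← mul_assoc, hGH, one_mul, mul_smul_comm, mul_one] at this
  have hdet : H.det * G.det = 1 := by rw [← det_mul, hHG, det_one]
  rw [eval_cornerMinor, h1, adjugate_mul_distrib, adjugate_mul_distrib, hG, hH, adjugate_diagonal,
    smul_mul_assoc, mul_smul_comm, mul_smul_comm, smul_smul, hdet, one_smul, mul_apply,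
    Finset.sum_eq_single j]
  · rw [diagonal_mul]; ring
  · intro k _ hk
    rw [diagonal_mul, Finset.prod_eq_zero (i := j) (by simp [hk.symm]) (sub_self _), zero_mul,
      mul_zero]
  · simp

theorem Matrix.charpoly_of_mul_eq_mul_diagonal {A G H : Matrix m m R} {d : m → R}
    (hGH : G * H = 1) (h : A * G = G * diagonal d) : A.charpoly = ∏ j, (X - C (d j)) := by
  have h1 : A = G * diagonal d * H := by rw [← h, mul_assoc, hGH, mul_one]
  have hu := charpoly_units_conj ⟨G, H, hGH, mul_eq_one_comm.mp hGH⟩ (diagonal d)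
  simp only [inv_eq_right_inv hGH] at hu
  rw [← charpoly_diagonal, h1, hu]

theorem Matrix.genericity_of_mul_eq_mul_diagonal {A G H : Matrix m m R} {d : m → R}
    (hGH : G * H = 1) (h : A * G = G * diagonal d) (i : m) :
    A.genericity i = (∏ j, d j) * (∏ j, ∏ k ∈ Finset.univ.erase j, (d j - d k)) *
      ∏ j, (G i j * H j i * ∏ k ∈ Finset.univ.erase j, (d j - d k)) := by
  have hA : A.det = ∏ j, d j := by
    simpa using det_aeval_of_mul_eq_mul_diagonal hGH h X
  have hchar := charpoly_of_mul_eq_mul_diagonal hGH h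
  rw [genericity, det_mul, det_mul, hA, det_aeval_of_mul_eq_mul_diagonal hGH h,
    det_aeval_of_mul_eq_mul_diagonal hGH h]
  congr 1
  · congr 1
    refine Finset.prod_congr rfl fun j _ => ?_
    rw [hchar, derivative_prod_finset, eval_finsetSum, Finset.sum_eq_single j]
    · simp [eval_prod]
    · intro k _ hk
      rw [eval_mul, eval_prod, Finset.prod_eq_zero (i := j) (by simp [hk.symm]) (by simp), zero_mul]
    · simp
  · exact Finset.prod_congr rfl fun j _ => eval_cornerMinor_of_mul_eq_mul_diagonal hGH h i j

end CommRing

theorem Matrix.exists_genericity_ne_zero {m : Type*} [Fintype m] [DecidableEq m] (i : m) :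
    ∃ D : Matrix m m ℝ, D.genericity i ≠ 0 := by
  set e := Fintype.equivFin m
  set d : m → ℝ := fun j => (e j : ℕ) + 1 with hd
  have hdinj : Function.Injective d := fun a b hab => by
    have : ((e a : ℕ) : ℝ) = (e b : ℕ) := by simpa [hd] using hab
    exact e.injective (Fin.ext (by exact_mod_cast this))
  set c : ℝ := (Fintype.card m : ℝ) with hc
  have hcard : 0 < Fintype.card m := Fintype.card_pos_iff.mpr ⟨i⟩
  have hcpos : 0 < c := by rw [hc]; exact_mod_cast hcard
  set J : Matrix m m ℝ := of fun _ _ => 1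
  have hJ : J * J = c • J := by
    ext a b
    simp [J, mul_apply, hc]
  set G : Matrix m m ℝ := 1 + J with hG
  set H : Matrix m m ℝ := 1 - (1 + c)⁻¹ • J with hH
  have hGH : G * H = 1 := by
    have h0 : (1 : ℝ) + c ≠ 0 := by positivity
    rw [hG, hH, mul_sub, add_mul, one_mul, mul_one, mul_smul_comm, add_mul, hJ, one_mul,
      show J + c • J = (1 + c) • J by rw [add_smul, one_smul], smul_smul, inv_mul_cancel₀ h0, one_smul]
    abel
  have hsub : ∀ j, ∏ k ∈ Finset.univ.erase j, (d j - d k) ≠ 0 := fun j =>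
    Finset.prod_ne_zero_iff.mpr fun k hk =>
      sub_ne_zero.mpr fun h => Finset.ne_of_mem_erase hk (hdinj h).symm
  refine ⟨G * diagonal d * H, ?_⟩
  rw [genericity_of_mul_eq_mul_diagonal (G := G) (H := H) (d := d) hGH
    (by rw [mul_assoc, mul_eq_one_comm.mp hGH, mul_one])]
  refine mul_ne_zero (mul_ne_zero ?_ ?_) ?_
  · exact Finset.prod_ne_zero_iff.mpr fun j _ => by simp only [hd]; positivity
  · exact Finset.prod_ne_zero_iff.mpr fun j _ => hsub j
  · refine Finset.prod_ne_zero_iff.mpr fun j _ => mul_ne_zero (mul_ne_zero ?_ ?_) (hsub j)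
    · by_cases hij : i = j
      · subst hij; simp [hG, J]
      · simp [hG, J, hij]
    · by_cases hij : j = i
      · subst hij
        have : (1 : ℝ) - (1 + c)⁻¹ = c / (1 + c) := by field_simp; ring
        simp only [hH, J, sub_apply, one_apply_eq, smul_apply, of_apply, smul_eq_mul, mul_one, this]
        positivity
      · simp only [hH, J, sub_apply, one_apply_ne hij, smul_apply, of_apply, smul_eq_mul, mul_one,
          zero_sub]
        exact neg_ne_zero.mpr (by positivity)

theorem Matrix.continuous_genericity {m : Type*} [Fintype m] [DecidableEq m] (i : m) :
    Continuous fun A : Matrix m m ℝ => A.genericity i := by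
  have h : (fun A : Matrix m m ℝ => A.genericity i) = fun A =>
      MvPolynomial.eval (fun p : m × m => A p.1 p.2) ((mvPolynomialX m m ℝ).genericity i) := by
    funext A
    rw [← genericity_map, ← RingHom.mapMatrix_apply, mvPolynomialX_mapMatrix_eval]
  rw [h]
  exact (MvPolynomial.continuous_eval _).comp (by fun_prop)

theorem Matrix.dense_genericity_ne_zero {m : Type*} [Fintype m] [DecidableEq m] (i : m) :
    Dense {A : Matrix m m ℝ | A.genericity i ≠ 0} := by
  intro A
  obtain ⟨D, hD⟩ := exists_genericity_ne_zero i
  set B : Matrix m m ℝ[X] := A.map C + (X : ℝ[X]) • (D - A).map C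
  have hB : ∀ t : ℝ, B.map (evalRingHom t) = A + t • (D - A) := by
    intro t; ext a b; simp [B]
  have heval : ∀ t : ℝ, (B.genericity i).eval t = (A + t • (D - A)).genericity i := by
    intro t
    rw [← hB, genericity_map]; rfl
  have hne : B.genericity i ≠ 0 := by
    intro h0
    have := heval 1
    rw [h0, one_smul, add_sub_cancel] at this
    exact hD (by simpa using this.symm)
  have hev : ∀ᶠ t in 𝓝[≠] (0 : ℝ), A + t • (D - A) ∈ {A : Matrix m m ℝ | A.genericity i ≠ 0} := by
    have hfin : (((B.genericity i).roots.toFinset : Set ℝ) \ {0}).Finite :=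
      (Finset.finite_toSet _).subset Set.sdiff_subset
    have hmem : (((B.genericity i).roots.toFinset : Set ℝ) \ {0})ᶜ ∈ 𝓝 (0 : ℝ) :=
      hfin.isClosed.isOpen_compl.mem_nhds fun h => h.2 rfl
    filter_upwards [nhdsWithin_le_nhds hmem, self_mem_nhdsWithin] with t ht ht0
    intro h
    refine ht ⟨?_, ht0⟩
    rw [Finset.mem_coe, Multiset.mem_toFinset, mem_roots hne, IsRoot, heval, h]
  refine mem_closure_of_tendsto (b := 𝓝[≠] (0 : ℝ)) ?_ hev
  have : Continuous fun t : ℝ => A + t • (D - A) := by fun_prop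
  simpa using (this.tendsto 0).mono_left nhdsWithin_le_nhds

/-- A real matrix regarded as a complex one. -/
abbrev Matrix.complexify {m : Type*} (A : Matrix m m ℝ) : Matrix m m ℂ :=
  A.map Complex.ofRealHom

section Eigenvalues

variable {n : ℕ} {A : Matrix (Fin n) (Fin n) ℝ}

theorem mem_eigenvalues_iff_isRoot {μ : ℂ} :
    μ ∈ eigenvalues A ↔ A.complexify.charpoly.IsRoot μ := by
  rw [IsRoot, eval_charpoly, ← exists_mulVec_eq_zero_iff]
  refine exists_congr fun v => and_congr_right fun _ => ?_
  rw [sub_mulVec, sub_eq_zero, scalar_apply, ← smul_one_eq_diagonal, smul_mulVec, one_mulVec,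
    eq_comm]
  rfl

theorem eigenvalues_eq_spectrum : eigenvalues A = spectrum ℂ A.complexify := by
  ext μ
  rw [mem_eigenvalues_iff_isRoot, mem_spectrum_iff_isRoot_charpoly]

theorem eigenvalues_eq_roots :
    eigenvalues A = (A.complexify.charpoly.roots.toFinset : Set ℂ) := by
  ext μ
  rw [mem_eigenvalues_iff_isRoot, Finset.mem_coe, Multiset.mem_toFinset,
    mem_roots (charpoly_monic _).ne_zero]

theorem card_roots_charpoly_complexify (A : Matrix (Fin n) (Fin n) ℝ) :
    A.complexify.charpoly.roots.card = n := by
  rw [← (IsAlgClosed.splits A.complexify.charpoly).natDegree_eq_card_roots,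
    charpoly_natDegree_eq_dim, Fintype.card_fin]

theorem finite_eigenvalues (A : Matrix (Fin n) (Fin n) ℝ) : (eigenvalues A).Finite := by
  rw [eigenvalues_eq_roots]; exact Finset.finite_toSet _

theorem ncard_eigenvalues_le (A : Matrix (Fin n) (Fin n) ℝ) : (eigenvalues A).ncard ≤ n := by
  rw [eigenvalues_eq_roots, Set.ncard_coe_finset]
  exact (Multiset.toFinset_card_le _).trans_eq (card_roots_charpoly_complexify A)

theorem eigenvalues_nonempty (hn : 0 < n) (A : Matrix (Fin n) (Fin n) ℝ) :
    (eigenvalues A).Nonempty := by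
  have : 0 < A.complexify.charpoly.roots.card := by rwa [card_roots_charpoly_complexify]
  obtain ⟨μ, hμ⟩ := Multiset.card_pos_iff_exists_mem.mp this
  exact ⟨μ, by simpa [eigenvalues_eq_roots] using hμ⟩

theorem conj_mem_eigenvalues {μ : ℂ} (hμ : μ ∈ eigenvalues A) :
    starRingEnd ℂ μ ∈ eigenvalues A := by
  have h : ∀ z : ℂ, z ∈ eigenvalues A ↔ aeval z A.charpoly = 0 := fun z => by
    rw [mem_eigenvalues_iff_isRoot, charpoly_map, IsRoot, eval_map, aeval_def]
    rfl
  rw [h] at hμ ⊢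
  rw [aeval_conj, hμ, map_zero]

theorem eventually_exists_eigenvalue_near {s : ℂ} (hs : s ∈ eigenvalues A) {ε : ℝ} (hε : 0 < ε) :
    ∀ᶠ B in 𝓝 A, ∃ μ ∈ eigenvalues B, dist μ s < ε := by
  have hcont : Continuous fun B : Matrix (Fin n) (Fin n) ℝ =>
      ‖(scalar (Fin n) s - B.complexify).det‖ := by
    have : Continuous fun B : Matrix (Fin n) (Fin n) ℝ => B.complexify :=
      continuous_id.matrix_map Complex.continuous_ofReal
    exact (continuous_const.sub this).matrix_det.norm
  have h0 : ‖(scalar (Fin n) s - A.complexify).det‖ < ε ^ n := by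
    rw [← eval_charpoly, (mem_eigenvalues_iff_isRoot.mp hs).eq_zero, norm_zero]
    positivity
  filter_upwards [hcont.tendsto A |>.eventually_lt_const h0] with B hB
  by_contra! hfar
  refine hB.not_ge ?_
  rw [← eval_charpoly, (IsAlgClosed.splits _).eval_eq_prod_roots_of_monic (charpoly_monic _),
    ← coe_nnnorm, ← nnnormHom_apply, map_multiset_prod, Multiset.map_map]
  have := Multiset.pow_card_le_prod
    (s := B.complexify.charpoly.roots.map (nnnormHom ∘ fun r => s - r)) (a := ⟨ε, hε.le⟩) (by
      intro x hx
      obtain ⟨r, hr, rfl⟩ := Multiset.mem_map.mp hx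
      have := hfar r (by simpa [eigenvalues_eq_roots] using hr)
      rw [dist_comm, dist_eq_norm] at this
      exact this)
  rw [Multiset.card_map, card_roots_charpoly_complexify] at this
  exact NNReal.coe_le_coe.mpr this

theorem continuous_eval_cornerMinor_complexify (i : Fin n) :
    Continuous fun p : Matrix (Fin n) (Fin n) ℝ × ℂ =>
      (p.1.complexify.cornerMinor i).eval p.2 := by
  simp only [eval_cornerMinor]
  have h1 : Continuous fun p : Matrix (Fin n) (Fin n) ℝ × ℂ => p.1.complexify :=
    continuous_fst.matrix_map Complex.continuous_ofReal
  have h2 : Continuous fun p : Matrix (Fin n) (Fin n) ℝ × ℂ => scalar (Fin n) p.2 := by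
    simp only [scalar_apply]
    exact (continuous_pi fun _ => continuous_snd).matrix_diagonal
  exact ((h2.sub h1).matrix_adjugate).matrix_elem i i

theorem exists_diagonalization (hcard : (eigenvalues A).ncard = n) (i : Fin n) {μ : ℂ}
    (hμ : μ ∈ eigenvalues A) :
    ∃ G H : Matrix (Fin n) (Fin n) ℂ, ∃ d : Fin n → ℂ, G * H = 1 ∧
      A.complexify * G = G * diagonal d ∧ d i = μ := by
  have := (finite_eigenvalues A).to_subtype
  have hc : Nat.card (Fin n) = Nat.card (eigenvalues A) := by
    rw [Nat.card_fin, Nat.card_coe_set_eq, hcard]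
  obtain ⟨e₀⟩ := Finite.card_eq.mp hc
  set e : Fin n ≃ eigenvalues A := (Equiv.swap i (e₀.symm ⟨μ, hμ⟩)).trans e₀
  have he : (e i : ℂ) = μ := by simp [e]
  choose v hv0 hv using fun j => (e j).2
  have hli : LinearIndependent ℂ v := by
    refine Module.End.eigenvectors_linearIndependent' (Matrix.toLin' A.complexify)
      (fun j => (e j : ℂ)) (Subtype.val_injective.comp e.injective) v fun j => ?_
    exact Module.End.hasEigenvector_iff.mpr
      ⟨Module.End.mem_eigenspace_iff.mpr (by rw [toLin'_apply]; exact hv j), hv0 j⟩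
  set G : Matrix (Fin n) (Fin n) ℂ := (of v)ᵀ
  have hG : IsUnit G := linearIndependent_cols_iff_isUnit.mp hli
  refine ⟨G, G⁻¹, fun j => e j, mul_nonsing_inv _ ((isUnit_iff_isUnit_det _).mp hG), ?_, he⟩
  ext a b
  rw [mul_diagonal, mul_comm]
  exact congrFun (hv b) a

theorem of_genericity_ne_zero {i : Fin n} (h : A.genericity i ≠ 0) :
    (0 : ℂ) ∉ eigenvalues A ∧ (eigenvalues A).ncard = n ∧
      ∀ μ ∈ eigenvalues A, (A.complexify.cornerMinor i).eval μ ≠ 0 := by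
  have hC : A.complexify.genericity i ≠ 0 := by
    rw [genericity_map]
    exact (_root_.map_ne_zero _).mpr h
  rw [genericity, det_mul, det_mul, mul_ne_zero_iff, mul_ne_zero_iff] at hC
  obtain ⟨⟨h1, h2⟩, h3⟩ := hC
  have key : ∀ p : ℂ[X], (aeval A.complexify p).det ≠ 0 → ∀ μ ∈ eigenvalues A, p.eval μ ≠ 0 := by
    intro p hp μ hμ h0
    rw [eigenvalues_eq_spectrum] at hμ
    have hmem := spectrum.subset_polynomial_aeval A.complexify p ⟨μ, hμ, h0⟩
    exact (spectrum.zero_mem_iff ℂ).mp hmem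
      ((isUnit_iff_isUnit_det _).mpr (isUnit_iff_ne_zero.mpr hp))
  refine ⟨fun h0 => key X (by simpa using h1) 0 h0 (by simp), ?_, key _ h3⟩
  have hnodup : A.complexify.charpoly.roots.Nodup := by
    rw [Multiset.nodup_iff_count_le_one]
    intro μ
    by_contra! hlt
    rw [count_roots, one_lt_rootMultiplicity_iff_isRoot (charpoly_monic _).ne_zero] at hlt
    exact key _ h2 μ (mem_eigenvalues_iff_isRoot.mpr hlt.1) hlt.2
  rw [eigenvalues_eq_roots, Set.ncard_coe_finset, Multiset.toFinset_card_of_nodup hnodup,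
    card_roots_charpoly_complexify]

theorem eigenvalues_aeval (hn : 0 < n) (p : ℝ[X]) :
    eigenvalues (aeval A p) = (fun z => aeval z p) '' eigenvalues A := by
  rw [eigenvalues_eq_spectrum, eigenvalues_eq_spectrum, complexify, map_aeval,
    spectrum.map_polynomial_aeval_of_nonempty _ _
      (by rw [← eigenvalues_eq_spectrum]; exact eigenvalues_nonempty hn A)]
  refine Set.image_congr fun z _ => ?_
  rw [eval_map, aeval_def]
  rfl

end Eigenvalues

/-- Matrices with simple nonzero spectrum and a dominant eigenvalue (up to conjugation) at which
`cornerMinor i` does not vanish. -/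
def dominantSet {n : ℕ} (i : Fin n) : Set (Matrix (Fin n) (Fin n) ℝ) :=
  {A | (0 : ℂ) ∉ eigenvalues A ∧ (eigenvalues A).ncard = n ∧ ∃ lam ∈ eigenvalues A,
    (∀ μ ∈ eigenvalues A, μ ≠ lam → μ ≠ starRingEnd ℂ lam → μ.re < lam.re) ∧
      (A.complexify.cornerMinor i).eval lam ≠ 0}

section DominantSet

variable {n : ℕ} {A : Matrix (Fin n) (Fin n) ℝ}

theorem eigenvalues_eq_range {G H : Matrix (Fin n) (Fin n) ℂ} {d : Fin n → ℂ}
    (hGH : G * H = 1) (h : A.complexify * G = G * diagonal d) : eigenvalues A = Set.range d := by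
  ext μ
  rw [mem_eigenvalues_iff_isRoot, charpoly_of_mul_eq_mul_diagonal hGH h, IsRoot, eval_prod,
    Finset.prod_eq_zero_iff]
  simp [sub_eq_zero, eq_comm]

theorem injective_of_ncard_eigenvalues (hcard : (eigenvalues A).ncard = n)
    {G H : Matrix (Fin n) (Fin n) ℂ} {d : Fin n → ℂ}
    (hGH : G * H = 1) (h : A.complexify * G = G * diagonal d) : Function.Injective d := by
  classical
  rw [eigenvalues_eq_range hGH h, ← Set.image_univ, ← Finset.coe_univ, ← Finset.coe_image,
    Set.ncard_coe_finset] at hcard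
  have := Finset.card_image_iff.mp (hcard.trans (Finset.card_fin n).symm)
  simpa using this

theorem eval_cornerMinor_ne_zero_iff (hcard : (eigenvalues A).ncard = n)
    {G H : Matrix (Fin n) (Fin n) ℂ} {d : Fin n → ℂ}
    (hGH : G * H = 1) (h : A.complexify * G = G * diagonal d) (i : Fin n) :
    (A.complexify.cornerMinor i).eval (d i) ≠ 0 ↔ G i i * H i i ≠ 0 := by
  have hinj := injective_of_ncard_eigenvalues hcard hGH h
  have hprod : ∏ k ∈ Finset.univ.erase i, (d i - d k) ≠ 0 :=
    Finset.prod_ne_zero_iff.mpr fun k hk =>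
      sub_ne_zero.mpr fun h => Finset.ne_of_mem_erase hk (hinj h).symm
  rw [eval_cornerMinor_of_mul_eq_mul_diagonal hGH h, mul_ne_zero_iff, and_iff_left hprod]

theorem mem_dominantSet_iff (i : Fin n) :
    A ∈ dominantSet i ↔ ((0 : ℂ) ∉ eigenvalues A ∧ (eigenvalues A).ncard = n ∧
      ∃ lam₁ ∈ eigenvalues A, ∀ μ ∈ eigenvalues A,
        μ ≠ lam₁ → μ ≠ starRingEnd ℂ lam₁ → μ.re < lam₁.re) ∧
      ∃ G H : Matrix (Fin n) (Fin n) ℂ, ∃ lam : Fin n → ℂ,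
        G * H = 1 ∧ H * G = 1 ∧ H * A.complexify * G = diagonal lam ∧
        (∀ μ ∈ eigenvalues A, μ.re ≤ (lam i).re) ∧ G i i * H i i ≠ 0 := by
  constructor
  · rintro ⟨h0, hcard, lam, hlam, hdom, hq⟩
    obtain ⟨G, H, d, hGH, h, rfl⟩ := exists_diagonalization hcard i hlam
    have hHG := mul_eq_one_comm.mp hGH
    refine ⟨⟨h0, hcard, d i, hlam, hdom⟩, G, H, d, hGH, hHG, ?_, fun μ hμ => ?_,
      (eval_cornerMinor_ne_zero_iff hcard hGH h i).mp hq⟩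
    · rw [mul_assoc, h, ← mul_assoc, hHG, one_mul]
    · by_cases h1 : μ = d i
      · rw [h1]
      by_cases h2 : μ = starRingEnd ℂ (d i)
      · rw [h2, Complex.conj_re]
      exact (hdom μ hμ h1 h2).le
  · rintro ⟨⟨h0, hcard, lam₁, hlam₁, hdom⟩, G, H, d, hGH, hHG, hd, hmax, hne⟩
    have h : A.complexify * G = G * diagonal d := by
      rw [← hd, ← mul_assoc, ← mul_assoc, hGH, one_mul]
    have hmem : d i ∈ eigenvalues A := by
      rw [eigenvalues_eq_range hGH h]; exact ⟨i, rfl⟩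
    refine ⟨h0, hcard, d i, hmem, fun μ hμ h1 h2 => ?_,
      (eval_cornerMinor_ne_zero_iff hcard hGH h i).mpr hne⟩
    have hor : d i = lam₁ ∨ d i = starRingEnd ℂ lam₁ := by
      by_contra! hcon
      exact (hdom _ hmem hcon.1 hcon.2).not_ge (hmax lam₁ hlam₁)
    rcases hor with h3 | h3
    · rw [h3] at h1 h2 ⊢
      exact hdom μ hμ h1 h2
    · rw [h3] at h1 h2 ⊢
      rw [Complex.conj_conj] at h2
      rw [Complex.conj_re]
      exact hdom μ hμ h2 h1

theorem isOpen_dominantSet (i : Fin n) : IsOpen (dominantSet i) := by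
  rw [isOpen_iff_mem_nhds]
  rintro A ⟨h0, hcard, lam, hlam, hdom, hq⟩
  set S := eigenvalues A with hS
  have hfin : S.Finite := finite_eigenvalues A
  have hsmall : ∀ c : ℝ, 0 < c → ∀ᶠ ε in 𝓝[>] (0 : ℝ), 2 * ε < c := fun c hc => by
    filter_upwards [Ioo_mem_nhdsGT (half_pos hc)] with ε hε
    linarith [hε.2]
  have e1 : ∀ᶠ ε in 𝓝[>] (0 : ℝ), ∀ s ∈ S, ∀ t ∈ S, s ≠ t → 2 * ε < dist s t := by
    rw [eventually_all_finite hfin]; intro s hs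
    rw [eventually_all_finite hfin]; intro t ht
    by_cases hst : s = t
    · simp [hst]
    · filter_upwards [hsmall _ (dist_pos.mpr hst)] with ε hε _ using hε
  have e2 : ∀ᶠ ε in 𝓝[>] (0 : ℝ), ∀ s ∈ S, 2 * ε < ‖s‖ := by
    rw [eventually_all_finite hfin]; intro s hs
    exact hsmall _ (norm_pos_iff.mpr fun h => h0 (h ▸ hs))
  have e3 : ∀ᶠ ε in 𝓝[>] (0 : ℝ), ∀ s ∈ S, s ≠ lam → s ≠ starRingEnd ℂ lam →
      2 * ε < lam.re - s.re := by
    rw [eventually_all_finite hfin]; intro s hs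
    by_cases h1 : s = lam
    · simp [h1]
    by_cases h2 : s = starRingEnd ℂ lam
    · simp [h2]
    filter_upwards [hsmall _ (sub_pos.mpr (hdom s hs h1 h2))] with ε hε _ _ using hε
  have hqev : ∀ᶠ p in 𝓝 A ×ˢ 𝓝 lam, (p.1.complexify.cornerMinor i).eval p.2 ≠ 0 := by
    rw [← nhds_prod_eq]
    exact (continuous_eval_cornerMinor_complexify i).continuousAt.eventually_ne hq
  obtain ⟨P, hP, Q, hQ, hPQ⟩ := eventually_prod_iff.mp hqev
  obtain ⟨δ, hδ, hball⟩ := Metric.eventually_nhds_iff.mp hQ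
  obtain ⟨ε, ⟨hs1, hs2, hs3, hεδ⟩, hε⟩ :=
    ((e1.and (e2.and (e3.and (hsmall δ hδ)))).and self_mem_nhdsWithin).exists
  have hε : 0 < ε := hε
  have hnear : ∀ᶠ B in 𝓝 A, ∀ s ∈ S, ∃ μ ∈ eigenvalues B, dist μ s < ε := by
    rw [eventually_all_finite hfin]
    exact fun s hs => eventually_exists_eigenvalue_near hs hε
  filter_upwards [hnear, hP] with B hB hPB
  choose! f hfmem hfdist using hB
  have huniq : ∀ z : ℂ, ∀ s ∈ S, ∀ t ∈ S, dist z s < ε → dist z t < ε → s = t := by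
    intro z s hs t ht h1 h2
    by_contra hst
    linarith [hs1 s hs t ht hst, dist_triangle_left s t z]
  have hinj : Set.InjOn f S := fun s hs t ht hst =>
    huniq (f s) s hs t ht (hfdist s hs) (hst ▸ hfdist t ht)
  have hncard : (f '' S).ncard = n := by rw [hinj.ncard_image, hcard]
  have himage : f '' S = eigenvalues B :=
    Set.eq_of_subset_of_ncard_le (Set.image_subset_iff.mpr hfmem)
      (by rw [hncard]; exact ncard_eigenvalues_le B) (finite_eigenvalues B)
  have hre : ∀ s ∈ S, |(f s).re - s.re| < ε := fun s hs => by
    rw [← Complex.sub_re]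
    exact (Complex.abs_re_le_norm _).trans_lt (by simpa [dist_eq_norm] using hfdist s hs)
  refine ⟨?_, by rw [← himage, hncard], f lam, hfmem lam hlam, ?_, ?_⟩
  · rw [← himage]
    rintro ⟨s, hs, hfs⟩
    have h1 := hfdist s hs
    rw [hfs, dist_zero_left] at h1
    linarith [hs2 s hs]
  · intro μ hμ h1 h2
    rw [← himage] at hμ
    obtain ⟨s, hs, rfl⟩ := hμ
    have hne1 : s ≠ lam := fun h => h1 (h ▸ rfl)
    have hne2 : s ≠ starRingEnd ℂ lam := by
      rintro rfl
      have hc := conj_mem_eigenvalues (hfmem _ hs)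
      rw [← himage] at hc
      obtain ⟨t, ht, hft⟩ := hc
      have hd : dist (f t) lam < ε := by
        have := hfdist _ hs
        rwa [hft, ← Complex.dist_conj_conj, Complex.conj_conj]
      have htl : t = lam := huniq _ t ht lam hlam (hfdist t ht) hd
      rw [htl] at hft
      exact h2 (by rw [hft, Complex.conj_conj])
    have h3 := abs_lt.mp (hre s hs)
    have h4 := abs_lt.mp (hre lam hlam)
    linarith [hs3 s hs hne1 hne2, h3.2, h4.1]
  · exact hPQ hPB (hball (by linarith [hfdist lam hlam]))

theorem mem_closure_dominantSet_of_genericity_ne_zero {i : Fin n} (h : A.genericity i ≠ 0) :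
    A ∈ closure (dominantSet i) := by
  have hn : 0 < n := i.pos
  obtain ⟨lam₀, hlam₀, hmax₀⟩ := Set.exists_max_image _ Complex.re (finite_eigenvalues A)
    (eigenvalues_nonempty hn A)
  set ρ := lam₀.re with hρ
  obtain ⟨lam, ⟨hlam, hlamre⟩, hmax⟩ := Set.exists_max_image {z ∈ eigenvalues A | z.re = ρ}
    (fun z => |z.im|) ((finite_eigenvalues A).subset (Set.sep_subset _ _)) ⟨lam₀, hlam₀, rfl⟩
  set p : ℝ → ℝ[X] := fun ε => X - C ε * (X - C ρ) ^ 2 with hp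
  set B : ℝ → Matrix (Fin n) (Fin n) ℝ := fun ε => aeval A (p ε) with hB
  have hBeq : ∀ ε, B ε = A - ε • aeval A ((X - C ρ) ^ 2 : ℝ[X]) := fun ε => by
    simp [hB, hp, Algebra.smul_def]
  have hre : ∀ (ε : ℝ) (z : ℂ), (aeval z (p ε)).re = z.re - ε * ((z.re - ρ) ^ 2 - z.im ^ 2) := by
    intro ε z
    simp [hp, pow_two]
  have hBcont : Continuous B := by
    rw [funext hBeq]; fun_prop
  have hB0 : B 0 = A := by simp [hBeq]
  have hgen : ∀ᶠ ε in 𝓝[>] (0 : ℝ), (B ε).genericity i ≠ 0 := by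
    refine nhdsWithin_le_nhds (ContinuousAt.eventually_ne (g := fun ε => (B ε).genericity i) ?_ ?_)
    · exact ((continuous_genericity i).comp hBcont).continuousAt
    · rwa [hB0]
  have hdom : ∀ᶠ ε in 𝓝[>] (0 : ℝ), ∀ μ ∈ eigenvalues A, μ ≠ lam → μ ≠ starRingEnd ℂ lam →
      (aeval μ (p ε)).re < (aeval lam (p ε)).re := by
    rw [eventually_all_finite (finite_eigenvalues A)]
    intro μ hμ
    by_cases h1 : μ = lam
    · simp [h1]
    by_cases h2 : μ = starRingEnd ℂ lam
    · simp [h2]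
    rcases (hmax₀ μ hμ).lt_or_eq with hlt | heq
    · have hev : ∀ᶠ ε in 𝓝 (0 : ℝ), (aeval μ (p ε)).re < (aeval lam (p ε)).re := by
        simp only [hre]
        refine ContinuousAt.eventually_lt (by fun_prop) (by fun_prop) ?_
        simpa [hlamre] using hlt
      filter_upwards [nhdsWithin_le_nhds hev] with ε hε _ _ using hε
    · have him : |μ.im| < |lam.im| := by
        refine (hmax μ ⟨hμ, heq⟩).lt_of_ne fun habs => ?_
        rcases abs_eq_abs.mp habs with h3 | h3
        · exact h1 (Complex.ext (heq.trans hlamre.symm) h3)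
        · exact h2 (Complex.ext (by simpa using heq.trans hlamre.symm) (by simpa using h3))
      have hsq := sq_lt_sq.mpr him
      filter_upwards [self_mem_nhdsWithin] with ε hε _ _
      have hε : 0 < ε := hε
      rw [hre, hre, hlamre, show μ.re = ρ from heq]
      have := mul_lt_mul_of_pos_left hsq hε
      linarith
  refine mem_closure_of_tendsto (f := B) (b := 𝓝[>] (0 : ℝ)) ?_ ?_
  · have := hBcont.tendsto 0
    rw [hB0] at this
    exact this.mono_left nhdsWithin_le_nhds
  · filter_upwards [hgen, hdom] with ε hg hd
    obtain ⟨h0, hcard, hq⟩ := of_genericity_ne_zero hg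
    have heig : eigenvalues (B ε) = _ := eigenvalues_aeval hn (p ε)
    have hmem : aeval lam (p ε) ∈ eigenvalues (B ε) := by
      rw [heig]; exact ⟨lam, hlam, rfl⟩
    refine ⟨h0, hcard, _, hmem, fun μ hμ h1 h2 => ?_, hq _ hmem⟩
    rw [heig] at hμ
    obtain ⟨z, hz, rfl⟩ := hμ
    refine hd z hz (fun h => h1 (h ▸ rfl)) fun h => h2 ?_
    rw [h]
    exact aeval_conj _ _

theorem dense_dominantSet (i : Fin n) : Dense (dominantSet i) :=
  ((dense_genericity_ne_zero i).mono
    fun _ h => mem_closure_dominantSet_of_genericity_ne_zero h).of_closure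

end DominantSet

theorem stmt15 {n : ℕ} (hn : 0 < n)
    (N : Set (Matrix (Fin n) (Fin n) ℝ))
    (hN : N = {A | (0:ℂ) ∉ eigenvalues A ∧ (eigenvalues A).ncard = n ∧
      ∃ lam₁ ∈ eigenvalues A, ∀ μ ∈ eigenvalues A,
        μ ≠ lam₁ → μ ≠ starRingEnd ℂ lam₁ → μ.re < lam₁.re})
    (M : Set (Matrix (Fin n) (Fin n) ℝ))
    (hM : M = {A ∈ N | ∃ G H : Matrix (Fin n) (Fin n) ℂ, ∃ lam : Fin n → ℂ,
      G * H = 1 ∧ H * G = 1 ∧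
      H * A.map (fun x : ℝ => (x : ℂ)) * G = Matrix.diagonal lam ∧
      (∀ μ ∈ eigenvalues A, μ.re ≤ (lam ⟨0, hn⟩).re) ∧
      G ⟨0, hn⟩ ⟨0, hn⟩ * H ⟨0, hn⟩ ⟨0, hn⟩ ≠ 0}) :
    IsOpen M ∧ Dense M := by
  have h : M = dominantSet ⟨0, hn⟩ := by
    ext A
    rw [mem_dominantSet_iff, hM, hN]
    exact Iff.rfl
  rw [h]
  exact ⟨isOpen_dominantSet _, dense_dominantSet _⟩
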